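/- arXiv:2605.18845 — 5 statements merged into one kernel-verified Lean document; each statement's English description precedes it below -/
import Mathlib

section
/- Let E be a real inner product space, θ, g ∈ E with θ ≠ 0, η, λ > 0 with η·λ < 1, and 0 ≤ c₁ < 1. If ‖g‖ ≤ c₁·η·λ·‖θ‖ and θ' = (1−η·λ)·θ − η·g, then (1−η·λ)² − 2·c₁·η²·λ − c₁²·η⁴·λ² ≤ ‖θ'‖²/‖θ‖² ≤ (1−η·λ)² + 2·c₁·η²·λ + c₁²·η⁴·λ². -/
/-- Small-gradient regime: two-sided bound on the one-step contraction ratio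
`‖θ'‖²/‖θ‖²` of SGD with decoupled weight decay. -/
theorem sgd_wd_step_ratio_bound {E : Type*} [NormedAddCommGroup E] [InnerProductSpace ℝ E]
    (θ g θ' : E) (hθ : θ ≠ 0) (η lam c₁ : ℝ) (hη : 0 < η) (hlam : 0 < lam)
    (hηlam : η * lam < 1) (hc₁0 : 0 ≤ c₁) (hc₁1 : c₁ < 1)
    (hg : ‖g‖ ≤ c₁ * η * lam * ‖θ‖)
    (hstep : θ' = (1 - η * lam) • θ - η • g) :
    (1 - η * lam) ^ 2 - 2 * c₁ * η ^ 2 * lam - c₁ ^ 2 * η ^ 4 * lam ^ 2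
        ≤ ‖θ'‖ ^ 2 / ‖θ‖ ^ 2 ∧
      ‖θ'‖ ^ 2 / ‖θ‖ ^ 2
        ≤ (1 - η * lam) ^ 2 + 2 * c₁ * η ^ 2 * lam + c₁ ^ 2 * η ^ 4 * lam ^ 2 := by
  have hθpos : 0 < ‖θ‖ ^ 2 := by positivity
  obtain ⟨s, hs⟩ : ∃ s, s = c₁ * η ^ 2 * lam := ⟨_, rfl⟩
  obtain ⟨a, ha⟩ : ∃ a, a = 1 - η * lam := ⟨_, rfl⟩
  have hs0 : 0 ≤ s := by rw [hs]; positivity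
  have ha0 : 0 ≤ a := by linarith
  have ha1 : a ≤ 1 := by linarith [mul_pos hη hlam]
  have hnorm : ‖η • g‖ ≤ s * ‖θ‖ := by
    rw [norm_smul, Real.norm_of_nonneg hη.le, hs]
    calc η * ‖g‖ ≤ η * (c₁ * η * lam * ‖θ‖) := by gcongr
      _ = c₁ * η ^ 2 * lam * ‖θ‖ := by ring
  have hsq : ‖η • g‖ ^ 2 ≤ s ^ 2 * ‖θ‖ ^ 2 := by
    rw [← mul_pow]
    gcongr
  have hinner : |inner ℝ θ (η • g)| ≤ s * ‖θ‖ ^ 2 :=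
    calc |inner ℝ θ (η • g)| ≤ ‖θ‖ * ‖η • g‖ := abs_real_inner_le_norm _ _
      _ ≤ ‖θ‖ * (s * ‖θ‖) := by gcongr
      _ = s * ‖θ‖ ^ 2 := by ring
  have hcross : |a * inner ℝ θ (η • g)| ≤ s * ‖θ‖ ^ 2 := by
    rw [abs_mul, abs_of_nonneg ha0]
    exact (mul_le_of_le_one_left (abs_nonneg _) ha1).trans hinner
  have hexp : ‖θ'‖ ^ 2 = a ^ 2 * ‖θ‖ ^ 2 - 2 * (a * inner ℝ θ (η • g)) + ‖η • g‖ ^ 2 := by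
    rw [hstep, ← ha, norm_sub_sq_real, norm_smul a θ, Real.norm_of_nonneg ha0,
      real_inner_smul_left, mul_pow]
  obtain ⟨hlow, hupp⟩ := abs_le.mp hcross
  rw [le_div_iff₀ hθpos, div_le_iff₀ hθpos, hexp, ← ha,
    show 2 * c₁ * η ^ 2 * lam = 2 * s by rw [hs]; ring,
    show c₁ ^ 2 * η ^ 4 * lam ^ 2 = s ^ 2 by rw [hs]; ring]
  have hsθ : 0 ≤ s ^ 2 * ‖θ‖ ^ 2 := by positivity
  constructor <;> linarith [sq_nonneg ‖η • g‖]
end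

section
/- Let E be a real inner product space and let θ : ℕ → E, g : ℕ → E satisfy θ_{t+1} = (1−η·λ)·θ_t − η·g_t for all t ≥ t₁, with η, λ > 0, η·λ < 1, 0 ≤ c₁ < 1, ‖g_t‖ ≤ c₁·η·λ·‖θ_t‖ for all t ≥ t₁, and θ_{t₁} ≠ 0. Set V_t := ‖θ_t‖² and q₊ := (1−η·λ)² + 2·c₁·η²·λ + c₁²·η⁴·λ², and assume q₊ < 1. Then for every n ∈ ℕ, V_{t₁+n} ≤ q₊ⁿ·V_{t₁}; consequently, for every target 0 < V_tar ≤ V_{t₁} and every n ∈ ℕ with n ≥ log(V_{t₁}/V_tar)/(−log q₊), one has V_{t₁+n} ≤ V_tar. -/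
/-- If `(a + b) ^ 2 ≤ q`, subtracting from `a • x` a vector of norm at most `b * ‖x‖` scales the
squared norm by at most `q`. -/
theorem norm_smul_sub_sq_le {E : Type*} [SeminormedAddCommGroup E] [NormedSpace ℝ E]
    {x y : E} {a b q : ℝ} (ha : 0 ≤ a) (hy : ‖y‖ ≤ b * ‖x‖) (hq : (a + b) ^ 2 ≤ q) :
    ‖a • x - y‖ ^ 2 ≤ q * ‖x‖ ^ 2 := by
  have h : ‖a • x - y‖ ≤ (a + b) * ‖x‖ := by
    calc ‖a • x - y‖ ≤ ‖a • x‖ + ‖y‖ := norm_sub_le _ _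
      _ = a * ‖x‖ + ‖y‖ := by rw [norm_smul, Real.norm_of_nonneg ha]
      _ ≤ (a + b) * ‖x‖ := by linarith
  calc ‖a • x - y‖ ^ 2 ≤ ((a + b) * ‖x‖) ^ 2 := by gcongr
    _ = (a + b) ^ 2 * ‖x‖ ^ 2 := mul_pow _ _ _
    _ ≤ q * ‖x‖ ^ 2 := by gcongr

theorem pow_mul_le_of_log_div_le {q v w : ℝ} {n : ℕ} (hq0 : 0 < q) (hq1 : q < 1)
    (hv : 0 < v) (hw : 0 < w) (hn : Real.log (v / w) / (-Real.log q) ≤ n) :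
    q ^ n * v ≤ w := by
  have hlog : 0 < -Real.log q := neg_pos.mpr (Real.log_neg hq0 hq1)
  rw [div_le_iff₀ hlog, Real.log_div hv.ne' hw.ne'] at hn
  rw [← Real.log_le_log_iff (by positivity) hw, Real.log_mul (by positivity) hv.ne', Real.log_pow]
  linarith

/-- Discrete contraction (Proposition 1): in the small-gradient regime the
squared parameter norm `V_t = ‖θ_t‖²` contracts geometrically with factor
`q₊ = (1−ηλ)² + 2c₁η²λ + c₁²η⁴λ²`, and hence reaches any target
`0 < V_tar ≤ V_{t₁}` within `log(V_{t₁}/V_tar)/(−log q₊)` steps. -/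
theorem sgd_wd_contraction_upper {E : Type*} [NormedAddCommGroup E] [InnerProductSpace ℝ E]
    (θ g : ℕ → E) (t₁ : ℕ) (η lam c₁ : ℝ) (hη : 0 < η) (hlam : 0 < lam)
    (hηlam : η * lam < 1) (hc₁0 : 0 ≤ c₁) (hc₁1 : c₁ < 1)
    (hstep : ∀ t, t₁ ≤ t → θ (t + 1) = (1 - η * lam) • θ t - η • g t)
    (hg : ∀ t, t₁ ≤ t → ‖g t‖ ≤ c₁ * η * lam * ‖θ t‖)
    (hθ : θ t₁ ≠ 0)
    (qplus : ℝ)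
    (hq : qplus = (1 - η * lam) ^ 2 + 2 * c₁ * η ^ 2 * lam + c₁ ^ 2 * η ^ 4 * lam ^ 2)
    (hq1 : qplus < 1) :
    (∀ n : ℕ, ‖θ (t₁ + n)‖ ^ 2 ≤ qplus ^ n * ‖θ t₁‖ ^ 2) ∧
      ∀ Vtar : ℝ, 0 < Vtar → Vtar ≤ ‖θ t₁‖ ^ 2 →
        ∀ n : ℕ, Real.log (‖θ t₁‖ ^ 2 / Vtar) / (-Real.log qplus) ≤ (n : ℝ) →
          ‖θ (t₁ + n)‖ ^ 2 ≤ Vtar := by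
  have ha : 0 < 1 - η * lam := by linarith
  have hq0 : 0 < qplus := by rw [hq]; positivity
  have hle : ((1 - η * lam) + η * (c₁ * η * lam)) ^ 2 ≤ qplus := by
    have h : 0 ≤ 2 * c₁ * η ^ 3 * lam ^ 2 := by positivity
    rw [hq]
    linarith
  have hcontr : ∀ n : ℕ, ‖θ (t₁ + n)‖ ^ 2 ≤ qplus ^ n * ‖θ t₁‖ ^ 2 := by
    intro n
    induction n with
    | zero => simp
    | succ n ih =>
      have ht : t₁ ≤ t₁ + n := Nat.le_add_right _ _
      have hgn : ‖η • g (t₁ + n)‖ ≤ η * (c₁ * η * lam) * ‖θ (t₁ + n)‖ := by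
        rw [norm_smul, Real.norm_of_nonneg hη.le, mul_assoc]
        gcongr
        exact hg _ ht
      rw [← add_assoc, hstep _ ht, pow_succ' qplus, mul_assoc qplus]
      exact (norm_smul_sub_sq_le ha.le hgn hle).trans (by gcongr)
  exact ⟨hcontr, fun Vtar hpos htar n hn =>
    (hcontr n).trans (pow_mul_le_of_log_div_le hq0 hq1 (hpos.trans_le htar) hpos hn)⟩
end

section
/- Let E be a real inner product space and let θ : ℕ → E, g : ℕ → E satisfy θ_{t+1} = (1−η·λ)·θ_t − η·g_t for all t ≥ t₁, with η, λ > 0, η·λ < 1, 0 ≤ c₁ < 1, ‖g_t‖ ≤ c₁·η·λ·‖θ_t‖ for all t ≥ t₁, and θ_{t₁} ≠ 0. Set V_t := ‖θ_t‖² and q₋ := (1−η·λ)² − 2·c₁·η²·λ − c₁²·η⁴·λ², and assume q₋ > 0. Then V_{t+1} ≥ q₋·V_t for all t ≥ t₁; consequently, if T ≥ t₁ and 0 < V_tar < V_{t₁} satisfy V_T ≤ V_tar, then T − t₁ ≥ log(V_{t₁}/V_tar)/(−log q₋). -/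
/-- A shrinking step `a • x - η • y` with `0 ≤ a ≤ 1` and `‖y‖ ≤ b * ‖x‖` keeps at least the
fraction `a ^ 2 - 2 * η * b` of the squared norm. -/
theorem sq_norm_smul_sub_smul_ge {E : Type*} [NormedAddCommGroup E] [InnerProductSpace ℝ E]
    {x y : E} {a η b : ℝ} (ha0 : 0 ≤ a) (ha1 : a ≤ 1) (hη : 0 ≤ η) (hy : ‖y‖ ≤ b * ‖x‖) :
    (a ^ 2 - 2 * η * b) * ‖x‖ ^ 2 ≤ ‖a • x - η • y‖ ^ 2 := by
  have hinner : inner ℝ x y ≤ ‖x‖ * (b * ‖x‖) :=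
    (real_inner_le_norm x y).trans (by gcongr)
  have hbx : 0 ≤ ‖x‖ * (b * ‖x‖) := mul_nonneg (norm_nonneg x) ((norm_nonneg y).trans hy)
  have hcross : a * (η * inner ℝ x y) ≤ η * (‖x‖ * (b * ‖x‖)) :=
    calc a * (η * inner ℝ x y) ≤ a * (η * (‖x‖ * (b * ‖x‖))) := by gcongr
      _ ≤ η * (‖x‖ * (b * ‖x‖)) := mul_le_of_le_one_left (mul_nonneg hη hbx) ha1
  rw [norm_sub_sq_real, real_inner_smul_left, real_inner_smul_right, norm_smul, norm_smul,
    mul_pow, mul_pow, Real.norm_eq_abs, Real.norm_eq_abs, sq_abs, sq_abs]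
  nlinarith [mul_nonneg (sq_nonneg η) (sq_nonneg ‖y‖)]

/-- If `V` loses at most a factor `q` per step from `m` on, it needs at least
`log (V m / v) / (-log q)` steps to fall to the level `v`. -/
theorem log_div_neg_log_le_of_mul_le_succ {V : ℕ → ℝ} {q v : ℝ} {m T : ℕ} (hq0 : 0 < q)
    (hq1 : q < 1) (hV : ∀ t, m ≤ t → q * V t ≤ V (t + 1)) (hmT : m ≤ T) (hm : 0 < V m)
    (hv : 0 < v) (hT : V T ≤ v) :
    Real.log (V m / v) / (-Real.log q) ≤ (T : ℝ) - (m : ℝ) := by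
  have hpow_add (n : ℕ) : q ^ n * V m ≤ V (m + n) := by
    induction n with
    | zero => simp
    | succ n ih =>
      calc q ^ (n + 1) * V m = q * (q ^ n * V m) := by ring
        _ ≤ q * V (m + n) := by gcongr
        _ ≤ V (m + (n + 1)) := hV _ (Nat.le_add_right m n)
  have hpow : q ^ (T - m) * V m ≤ V T := by
    simpa only [Nat.add_sub_cancel' hmT] using hpow_add (T - m)
  rw [div_le_iff₀ (neg_pos.mpr (Real.log_neg hq0 hq1)), Real.log_div hm.ne' hv.ne']
  have hlog := Real.log_le_log (by positivity) (hpow.trans hT)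
  rw [Real.log_mul (by positivity) hm.ne', Real.log_pow, Nat.cast_sub hmT] at hlog
  linarith

/-- Lower bound on contraction time (Proposition 2): in the small-gradient regime
`V_{t+1} ≥ q₋·V_t` with `q₋ = (1−ηλ)² − 2c₁η²λ − c₁²η⁴λ²`, so the first-passage
time of `V_t = ‖θ_t‖²` to a target `0 < V_tar < V_{t₁}` is at least
`log(V_{t₁}/V_tar)/(−log q₋)`. -/
theorem sgd_wd_contraction_lower {E : Type*} [NormedAddCommGroup E] [InnerProductSpace ℝ E]
    (θ g : ℕ → E) (t₁ : ℕ) (η lam c₁ : ℝ) (hη : 0 < η) (hlam : 0 < lam)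
    (hηlam : η * lam < 1) (hc₁0 : 0 ≤ c₁) (hc₁1 : c₁ < 1)
    (hstep : ∀ t, t₁ ≤ t → θ (t + 1) = (1 - η * lam) • θ t - η • g t)
    (hg : ∀ t, t₁ ≤ t → ‖g t‖ ≤ c₁ * η * lam * ‖θ t‖)
    (hθ : θ t₁ ≠ 0)
    (qminus : ℝ)
    (hq : qminus = (1 - η * lam) ^ 2 - 2 * c₁ * η ^ 2 * lam - c₁ ^ 2 * η ^ 4 * lam ^ 2)
    (hq0 : 0 < qminus) :
    (∀ t, t₁ ≤ t → qminus * ‖θ t‖ ^ 2 ≤ ‖θ (t + 1)‖ ^ 2) ∧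
      ∀ T : ℕ, t₁ ≤ T → ∀ Vtar : ℝ, 0 < Vtar → Vtar < ‖θ t₁‖ ^ 2 →
        ‖θ T‖ ^ 2 ≤ Vtar →
          Real.log (‖θ t₁‖ ^ 2 / Vtar) / (-Real.log qminus) ≤ (T : ℝ) - (t₁ : ℝ) := by
  have hηlam0 : 0 < η * lam := mul_pos hη hlam
  have hcontract : ∀ t, t₁ ≤ t → qminus * ‖θ t‖ ^ 2 ≤ ‖θ (t + 1)‖ ^ 2 := by
    intro t ht
    rw [hstep t ht]
    refine le_trans ?_ (sq_norm_smul_sub_smul_ge (by linarith) (by linarith) hη.le (hg t ht))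
    gcongr
    have : 0 ≤ c₁ ^ 2 * η ^ 4 * lam ^ 2 := by positivity
    linarith
  have hq1 : qminus < 1 := by
    have h₁ : 0 ≤ 2 * c₁ * η ^ 2 * lam := by positivity
    have h₂ : 0 ≤ c₁ ^ 2 * η ^ 4 * lam ^ 2 := by positivity
    nlinarith
  have hθ0 : 0 < ‖θ t₁‖ ^ 2 := by positivity
  exact ⟨hcontract, fun T hT Vtar hVtar _ hle =>
    log_div_neg_log_le_of_mul_le_succ (V := fun t => ‖θ t‖ ^ 2) hq0 hq1 hcontract hT hθ0 hVtar hle⟩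
end

section
/- Let E be a real inner product space and let θ : ℕ → E, g : ℕ → E satisfy θ_{t+1} = (1−η·λ)·θ_t − η·g_t for all t ≥ t₁, with η, λ > 0, η·λ < 1, 0 ≤ c₁ < 1, ‖g_t‖ ≤ c₁·η·λ·‖θ_t‖ for all t ≥ t₁, and θ_{t₁} ≠ 0. Set V_t := ‖θ_t‖² and q₊ := (1−η·λ)² + 2·c₁·η²·λ + c₁²·η⁴·λ², and assume q₊ < 1. Then the parameter norm is strictly decreasing after t₁: for every t₂ > t₁, V_{t₂} < V_{t₁}. In particular, there is no t₂ > t₁ with V_{t₂} ≥ V_{t₁}: the contraction dynamics cannot pass from a state of squared norm V_{t₁} to any later state of squared norm at least V_{t₁}, so if the memorising interpolant has squared norm no larger than the generalising interpolant (V_mem ≤ V_post), no positive grokking delay can occur in the contraction regime. -/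
/-- One step of gradient descent with weight decay contracts the squared norm by the factor `q₊`. -/
theorem norm_sq_sgd_wd_step_le {E : Type*} [NormedAddCommGroup E] [NormedSpace ℝ E]
    {x v : E} {η lam c : ℝ} (hη : 0 < η) (hlam : 0 < lam) (hηlam : η * lam < 1) (hc : 0 ≤ c)
    (hv : ‖v‖ ≤ c * η * lam * ‖x‖) :
    ‖(1 - η * lam) • x - η • v‖ ^ 2 ≤
      ((1 - η * lam) ^ 2 + 2 * c * η ^ 2 * lam + c ^ 2 * η ^ 4 * lam ^ 2) * ‖x‖ ^ 2 := by
  have hnorm : ‖(1 - η * lam) • x - η • v‖ ≤ (1 - η * lam + c * η ^ 2 * lam) * ‖x‖ := by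
    calc ‖(1 - η * lam) • x - η • v‖ ≤ ‖(1 - η * lam) • x‖ + ‖η • v‖ := norm_sub_le _ _
      _ = (1 - η * lam) * ‖x‖ + η * ‖v‖ := by
        rw [norm_smul_of_nonneg (by linarith), norm_smul_of_nonneg hη.le]
      _ ≤ (1 - η * lam) * ‖x‖ + η * (c * η * lam * ‖x‖) := by gcongr
      _ = (1 - η * lam + c * η ^ 2 * lam) * ‖x‖ := by ring
  have hcross : 0 ≤ η * lam * (c * η ^ 2 * lam) := by positivity
  calc ‖(1 - η * lam) • x - η • v‖ ^ 2 ≤ ((1 - η * lam + c * η ^ 2 * lam) * ‖x‖) ^ 2 := by gcongr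
    _ = (1 - η * lam + c * η ^ 2 * lam) ^ 2 * ‖x‖ ^ 2 := mul_pow _ _ _
    _ ≤ _ := by gcongr; linarith

/-- Norm-separation necessity (Corollary): in the contraction regime with
`q₊ < 1` the squared parameter norm is strictly decreasing after `t₁`; in
particular the trajectory can never reach a later state with squared norm at
least `V_{t₁}`, so if `V_mem ≤ V_post` no positive grokking delay can occur. -/
theorem sgd_wd_norm_strictly_decreasing {E : Type*}
    [NormedAddCommGroup E] [InnerProductSpace ℝ E]
    (θ g : ℕ → E) (t₁ : ℕ) (η lam c₁ : ℝ) (hη : 0 < η) (hlam : 0 < lam)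
    (hηlam : η * lam < 1) (hc₁0 : 0 ≤ c₁) (hc₁1 : c₁ < 1)
    (hstep : ∀ t, t₁ ≤ t → θ (t + 1) = (1 - η * lam) • θ t - η • g t)
    (hg : ∀ t, t₁ ≤ t → ‖g t‖ ≤ c₁ * η * lam * ‖θ t‖)
    (hθ : θ t₁ ≠ 0)
    (qplus : ℝ)
    (hq : qplus = (1 - η * lam) ^ 2 + 2 * c₁ * η ^ 2 * lam + c₁ ^ 2 * η ^ 4 * lam ^ 2)
    (hq1 : qplus < 1) :
    (∀ t₂ : ℕ, t₁ < t₂ → ‖θ t₂‖ ^ 2 < ‖θ t₁‖ ^ 2) ∧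
      ¬ ∃ t₂ : ℕ, t₁ < t₂ ∧ ‖θ t₁‖ ^ 2 ≤ ‖θ t₂‖ ^ 2 := by
  have hstep_le : ∀ t, t₁ ≤ t → ‖θ (t + 1)‖ ^ 2 ≤ qplus * ‖θ t‖ ^ 2 := fun t ht => by
    rw [hstep t ht, hq]
    exact norm_sq_sgd_wd_step_le hη hlam hηlam hc₁0 (hg t ht)
  have hdecr : ∀ t₂ : ℕ, t₁ < t₂ → ‖θ t₂‖ ^ 2 < ‖θ t₁‖ ^ 2 := fun t₂ ht₂ => by
    induction t₂, Nat.succ_le_of_lt ht₂ using Nat.le_induction with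
    | base =>
      exact (hstep_le t₁ le_rfl).trans_lt
        (mul_lt_of_lt_one_left (pow_pos (norm_pos_iff.mpr hθ) 2) hq1)
    | succ t ht ih =>
      exact ((hstep_le t (Nat.le_of_succ_le ht)).trans
        (mul_le_of_le_one_left (sq_nonneg _) hq1.le)).trans_lt (ih ht)
  exact ⟨hdecr, fun ⟨t₂, ht₂, hle⟩ => (hdecr t₂ ht₂).not_ge hle⟩
end

section
/- Let E be a real inner product space and let θ, θ_post ∈ E with θ ≠ 0. Set ε := ‖θ_post‖/‖θ‖. Then |‖θ − θ_post‖²/‖θ‖² − 1| ≤ 2·ε + ε². Moreover, if ε < 1, then |log(‖θ − θ_post‖²) − log(‖θ‖²)| ≤ −2·log(1−ε). -/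
theorem abs_norm_sub_div_norm_sub_one_le {E : Type*} [NormedAddCommGroup E] {x : E}
    (hx : x ≠ 0) (y : E) : |‖x - y‖ / ‖x‖ - 1| ≤ ‖y‖ / ‖x‖ := by
  have hpos : 0 < ‖x‖ := norm_pos_iff.mpr hx
  rw [div_sub_one hpos.ne', abs_div, abs_of_pos hpos]
  gcongr
  simpa using abs_norm_sub_norm_le (x - y) x

theorem abs_sq_sub_one_le_of_abs_sub_one_le {r ε : ℝ} (h : |r - 1| ≤ ε) :
    |r ^ 2 - 1| ≤ 2 * ε + ε ^ 2 := by
  have hε : 0 ≤ ε := (abs_nonneg _).trans h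
  calc |r ^ 2 - 1| = |2 * (r - 1) + (r - 1) ^ 2| := by ring_nf
    _ ≤ |2 * (r - 1)| + |(r - 1) ^ 2| := abs_add_le _ _
    _ = 2 * |r - 1| + |r - 1| ^ 2 := by rw [abs_mul, abs_two, abs_pow]
    _ ≤ 2 * ε + ε ^ 2 := by gcongr

theorem abs_log_le_neg_log_one_sub {r ε : ℝ} (h : |r - 1| ≤ ε) (hε : ε < 1) :
    |Real.log r| ≤ -Real.log (1 - ε) := by
  obtain ⟨hl, hu⟩ := abs_le.mp h
  have hpos : 0 < 1 - ε := by linarith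
  have hr : 0 < r := by linarith
  refine abs_le.mpr ⟨?_, ?_⟩
  · rw [neg_neg]
    exact Real.log_le_log hpos (by linarith)
  · rw [← Real.log_inv]
    refine Real.log_le_log hr ?_
    rw [← one_div, le_div_iff₀ hpos]
    nlinarith [sq_nonneg ε]


/-- Rate-preservation lemma (algebraic core): with `ε = ‖θ_post‖/‖θ‖`, the
squared distance to the asymptote satisfies `|D/V − 1| ≤ 2ε + ε²`, and if
`ε < 1` then `|log D − log V| ≤ −2 log(1−ε)`. -/
theorem rate_preservation_core {E : Type*} [NormedAddCommGroup E] [InnerProductSpace ℝ E]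
    (θ θpost : E) (hθ : θ ≠ 0) (ε : ℝ) (hε : ε = ‖θpost‖ / ‖θ‖) :
    |‖θ - θpost‖ ^ 2 / ‖θ‖ ^ 2 - 1| ≤ 2 * ε + ε ^ 2 ∧
      (ε < 1 →
        |Real.log (‖θ - θpost‖ ^ 2) - Real.log (‖θ‖ ^ 2)| ≤ -(2 * Real.log (1 - ε))) := by
  have h : |‖θ - θpost‖ / ‖θ‖ - 1| ≤ ε := hε ▸ abs_norm_sub_div_norm_sub_one_le hθ θpost
  refine ⟨by simpa only [div_pow] using abs_sq_sub_one_le_of_abs_sub_one_le h, fun hε1 => ?_⟩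
  have hθ' : ‖θ‖ ≠ 0 := norm_ne_zero_iff.mpr hθ
  have hsub : ‖θ - θpost‖ ≠ 0 := by
    intro h0
    rw [h0, zero_div, zero_sub, abs_neg, abs_one] at h
    exact absurd hε1 h.not_gt
  rw [← Real.log_div (pow_ne_zero 2 hsub) (pow_ne_zero 2 hθ'), ← div_pow, Real.log_pow,
    Nat.cast_ofNat, abs_mul, abs_two, ← mul_neg]
  gcongr
  exact abs_log_le_neg_log_one_sub h hε1
end
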